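/- Under the setup of the entropy-regularized Frank-Wolfe step: let X ∈ D_n, let Y ∈ D_n minimize Y' ↦ ⟨∇J(X), Y'⟩_F + λH(Y') over D_n, set G = g(X) (so G ≥ 0) and Q = Q(X,Y), choose the stepsize s = 1 if Q ≤ 0 and s = min{G/(2Q), 1} if Q > 0, and set X' = X + s(Y − X). Then F(X') ≤ F(X); moreover if Q > 0 then F(X') ≤ F(X) − min{G/2, G²/(4Q)}, and if Q ≤ 0 then F(X') ≤ F(X) − G. -/

import Mathlib

/-- `D_n`: nonnegative matrices with every row and column sum equal to `1/n`. -/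
def Dset (n : ℕ) : Set (Matrix (Fin n) (Fin n) ℝ) :=
  {X | (∀ i j, 0 ≤ X i j) ∧ (∀ i, ∑ j, X i j = 1 / (n : ℝ)) ∧
    (∀ j, ∑ i, X i j = 1 / (n : ℝ))}

/-- Frobenius inner product of real matrices. -/
def frob {n : ℕ} (A B : Matrix (Fin n) (Fin n) ℝ) : ℝ :=
  ∑ i, ∑ j, A i j * B i j

/-- Negative entropy `H(X) = ∑ i j, X i j * log (X i j)` (with `0 log 0 = 0`). -/
noncomputable def negEntropy {n : ℕ} (X : Matrix (Fin n) (Fin n) ℝ) : ℝ :=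
  ∑ i, ∑ j, X i j * Real.log (X i j)

/-- `⟨∇J(X), Y⟩_F = B(X,Y) + ⟨C,Y⟩_F` for `J(X) = ½ B(X,X) + ⟨C,X⟩_F`. -/
def gradTerm {n : ℕ}
    (B : Matrix (Fin n) (Fin n) ℝ →ₗ[ℝ] Matrix (Fin n) (Fin n) ℝ →ₗ[ℝ] ℝ)
    (C X Y : Matrix (Fin n) (Fin n) ℝ) : ℝ :=
  B X Y + frob C Y

/-- `F(X) = J(X) + λ H(X)` where `J(X) = ½ B(X,X) + ⟨C,X⟩_F`. -/
noncomputable def Ffun {n : ℕ}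
    (B : Matrix (Fin n) (Fin n) ℝ →ₗ[ℝ] Matrix (Fin n) (Fin n) ℝ →ₗ[ℝ] ℝ)
    (C : Matrix (Fin n) (Fin n) ℝ) (lam : ℝ) (X : Matrix (Fin n) (Fin n) ℝ) : ℝ :=
  (1 / 2 : ℝ) * B X X + frob C X + lam * negEntropy X

/-- The gap function
`g(X) = ⟨∇J(X), X⟩_F + λH(X) − min_{Y ∈ D_n} (⟨∇J(X), Y⟩_F + λH(Y))`. -/
noncomputable def gapFun {n : ℕ}
    (B : Matrix (Fin n) (Fin n) ℝ →ₗ[ℝ] Matrix (Fin n) (Fin n) ℝ →ₗ[ℝ] ℝ)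
    (C : Matrix (Fin n) (Fin n) ℝ) (lam : ℝ) (X : Matrix (Fin n) (Fin n) ℝ) : ℝ :=
  gradTerm B C X X + lam * negEntropy X
    - sInf ((fun Y => gradTerm B C X Y + lam * negEntropy Y) '' Dset n)

lemma negEntropy_step {n : ℕ} (X Y : Matrix (Fin n) (Fin n) ℝ)
    (hX : ∀ i j, 0 ≤ X i j) (hY : ∀ i j, 0 ≤ Y i j) (s : ℝ) (h0 : 0 ≤ s) (h1 : s ≤ 1) :
    negEntropy (X + s • (Y - X)) ≤ negEntropy X + s * (negEntropy Y - negEntropy X) := by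
  have e : negEntropy X + s * (negEntropy Y - negEntropy X)
      = ∑ i, ∑ j, ((1 - s) * (X i j * Real.log (X i j)) + s * (Y i j * Real.log (Y i j))) := by
    simp only [negEntropy, Finset.sum_add_distrib, ← Finset.mul_sum]
    ring
  rw [e]
  unfold negEntropy
  refine Finset.sum_le_sum fun i _ => Finset.sum_le_sum fun j _ => ?_
  have hs' : 0 ≤ 1 - s := by linarith
  have h := Real.convexOn_mul_log.2 (Set.mem_Ici.2 (hX i j)) (Set.mem_Ici.2 (hY i j))
    hs' h0 (by ring)
  simp only [smul_eq_mul] at h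
  have e2 : (X + s • (Y - X)) i j = (1 - s) * X i j + s * Y i j := by
    simp only [Matrix.add_apply, Matrix.smul_apply, Matrix.sub_apply, smul_eq_mul]
    ring
  rw [e2]
  exact h

lemma frob_step {n : ℕ} (C X Y : Matrix (Fin n) (Fin n) ℝ) (s : ℝ) :
    frob C (X + s • (Y - X)) = frob C X + s * (frob C Y - frob C X) := by
  simp only [frob, Finset.mul_sum, ← Finset.sum_sub_distrib, ← Finset.sum_add_distrib]
  refine Finset.sum_congr rfl fun i _ => Finset.sum_congr rfl fun j _ => ?_
  simp only [Matrix.add_apply, Matrix.smul_apply, Matrix.sub_apply, smul_eq_mul]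
  ring

/-- The entropy-regularized Frank-Wolfe step with the explicit stepsize
(`s = 1` if `Q ≤ 0`, else `s = min{G/(2Q), 1}`) decreases `F`; moreover
`F(X') ≤ F(X) − min{G/2, G²/(4Q)}` when `Q > 0` and `F(X') ≤ F(X) − G`
when `Q ≤ 0` (and the gap satisfies `G ≥ 0`). -/
theorem enfw_step_decrease {n : ℕ} (hn : 1 ≤ n) {lam : ℝ} (hlam : 0 < lam)
    (B : Matrix (Fin n) (Fin n) ℝ →ₗ[ℝ] Matrix (Fin n) (Fin n) ℝ →ₗ[ℝ] ℝ)
    (hBsymm : ∀ Z W, B Z W = B W Z) (C : Matrix (Fin n) (Fin n) ℝ)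
    (X Y : Matrix (Fin n) (Fin n) ℝ) (hX : X ∈ Dset n) (hY : Y ∈ Dset n)
    (hYmin : ∀ Y' ∈ Dset n,
      gradTerm B C X Y + lam * negEntropy Y
        ≤ gradTerm B C X Y' + lam * negEntropy Y')
    (G Q s : ℝ) (hG : G = gapFun B C lam X)
    (hQ : Q = (1 / 2 : ℝ) * B (Y - X) (Y - X))
    (hs : s = if Q ≤ 0 then 1 else min (G / (2 * Q)) 1)
    (X' : Matrix (Fin n) (Fin n) ℝ) (hX' : X' = X + s • (Y - X)) :
    0 ≤ G ∧
    Ffun B C lam X' ≤ Ffun B C lam X ∧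
    (0 < Q → Ffun B C lam X' ≤ Ffun B C lam X - min (G / 2) (G ^ 2 / (4 * Q))) ∧
    (Q ≤ 0 → Ffun B C lam X' ≤ Ffun B C lam X - G) := by
  have hinf : sInf ((fun Y => gradTerm B C X Y + lam * negEntropy Y) '' Dset n)
      = gradTerm B C X Y + lam * negEntropy Y := by
    apply IsLeast.csInf_eq
    refine ⟨⟨Y, hY, rfl⟩, ?_⟩
    rintro _ ⟨Z, hZ, rfl⟩
    exact hYmin Z hZ
  unfold gapFun at hG
  rw [hinf] at hG
  have hG0 : 0 ≤ G := by
    have := hYmin X hX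
    linarith
  have key : ∀ t : ℝ, 0 ≤ t → t ≤ 1 →
      Ffun B C lam (X + t • (Y - X)) ≤ Ffun B C lam X - t * G + t ^ 2 * Q := by
    intro t h0 h1
    have hH := mul_le_mul_of_nonneg_left (negEntropy_step X Y hX.1 hY.1 t h0 h1) hlam.le
    have hf := frob_step C X Y t
    unfold gradTerm at hG
    unfold Ffun
    rw [hf, hG, hQ]
    simp only [map_add, map_smul, map_sub, LinearMap.add_apply, LinearMap.smul_apply,
      LinearMap.sub_apply, smul_eq_mul]
    rw [hBsymm Y X]
    nlinarith [hH]
  subst hX'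
  by_cases hQ0 : Q ≤ 0
  · rw [if_pos hQ0] at hs
    subst hs
    have := key 1 (by norm_num) le_rfl
    refine ⟨hG0, by linarith, fun h => by linarith, fun _ => by linarith⟩
  · rw [if_neg hQ0] at hs
    have hQp : 0 < Q := not_le.mp hQ0
    have main : Ffun B C lam (X + s • (Y - X))
        ≤ Ffun B C lam X - min (G / 2) (G ^ 2 / (4 * Q)) := by
      have hs0 : 0 ≤ s := by rw [hs]; positivity
      have hs1 : s ≤ 1 := by rw [hs]; exact min_le_right _ _
      have hk := key s hs0 hs1
      rcases le_total (G / (2 * Q)) 1 with h | h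
      · rw [min_eq_left h] at hs
        have e : s * G - s ^ 2 * Q = G ^ 2 / (4 * Q) := by
          rw [hs]; field_simp; ring
        have := min_le_right (G / 2) (G ^ 2 / (4 * Q))
        linarith
      · rw [min_eq_right h] at hs
        rw [le_div_iff₀ (by positivity)] at h
        have := min_le_left (G / 2) (G ^ 2 / (4 * Q))
        rw [hs] at hk ⊢
        linarith
    have hm : 0 ≤ min (G / 2) (G ^ 2 / (4 * Q)) := by positivity
    exact ⟨hG0, by linarith, fun _ => main, fun h => absurd h hQ0⟩
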